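/- Let d ≥ 1, let P be a compactly supported probability measure on ℝ^d, let σ > 0, and let g : ℝ^d → ℝ^d be bounded and measurable. Then the cross terms of the two score-matching objectives coincide: ∫ (∫ ⟨g(y), (x − y)/σ²⟩ · q_σ(y, x) dy) dP(x) = ∫ ⟨g(y), ∇log Q_σ(y)⟩ · Q_σ(y) dy, and both integrals are finite. -/

import Mathlib

open MeasureTheory Real Filter Topology
open scoped InnerProductSpace ENNReal BigOperators

/-- The Gaussian kernel `q_σ(y, x) = (2πσ²)^{-d/2} exp(−‖y − x‖²/(2σ²))` on `ℝ^d`. -/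
noncomputable def gaussKernel (d : ℕ) (σ : ℝ) (y x : EuclideanSpace ℝ (Fin d)) : ℝ :=
  (2 * π * σ ^ 2) ^ (-(d : ℝ) / 2) * Real.exp (-‖y - x‖ ^ 2 / (2 * σ ^ 2))

/-- The smoothed density `Q_σ(y) = ∫ q_σ(y, x) dP(x)`. -/
noncomputable def smoothedDensity (d : ℕ) (σ : ℝ)
    (P : Measure (EuclideanSpace ℝ (Fin d))) (y : EuclideanSpace ℝ (Fin d)) : ℝ :=
  ∫ x, gaussKernel d σ y x ∂P

/-- The score `∇ log Q_σ` of the smoothed density. -/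
noncomputable def score (d : ℕ) (σ : ℝ) (P : Measure (EuclideanSpace ℝ (Fin d)))
    (y : EuclideanSpace ℝ (Fin d)) : EuclideanSpace ℝ (Fin d) :=
  gradient (fun z => Real.log (smoothedDensity d σ P z)) y

/-- The gradient of the Gaussian kernel in its first argument. -/
noncomputable def gaussKernelGrad (d : ℕ) (σ : ℝ) (y x : EuclideanSpace ℝ (Fin d)) :
    EuclideanSpace ℝ (Fin d) :=
  gaussKernel d σ y x • (σ ^ 2)⁻¹ • (x - y)

theorem gaussKernel_pos (d : ℕ) {σ : ℝ} (hσ : 0 < σ) (y x : EuclideanSpace ℝ (Fin d)) :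
    0 < gaussKernel d σ y x := by
  unfold gaussKernel
  positivity

theorem continuous_gaussKernel (d : ℕ) (σ : ℝ) :
    Continuous fun p : EuclideanSpace ℝ (Fin d) × EuclideanSpace ℝ (Fin d) =>
      gaussKernel d σ p.2 p.1 := by
  unfold gaussKernel
  fun_prop

theorem continuous_gaussKernelGrad (d : ℕ) (σ : ℝ) :
    Continuous fun p : EuclideanSpace ℝ (Fin d) × EuclideanSpace ℝ (Fin d) =>
      gaussKernelGrad d σ p.2 p.1 := by
  unfold gaussKernelGrad
  have := continuous_gaussKernel d σ
  fun_prop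

theorem hasFDerivAt_gaussKernel (d : ℕ) (σ : ℝ) (y x : EuclideanSpace ℝ (Fin d)) :
    HasFDerivAt (fun z => gaussKernel d σ z x) (innerSL ℝ (gaussKernelGrad d σ y x)) y := by
  have h1 : HasFDerivAt (fun z : EuclideanSpace ℝ (Fin d) => z - x)
      (ContinuousLinearMap.id ℝ _) y := (hasFDerivAt_id y).sub_const x
  have h2 := ((h1.norm_sq.const_mul (-(2 * σ ^ 2)⁻¹)).exp).const_mul
    ((2 * π * σ ^ 2) ^ (-(d : ℝ) / 2))
  have hfun : (fun z => gaussKernel d σ z x) = fun z =>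
      (2 * π * σ ^ 2) ^ (-(d : ℝ) / 2) * Real.exp (-(2 * σ ^ 2)⁻¹ * ‖z - x‖ ^ 2) := by
    funext z
    unfold gaussKernel
    congr 2
    ring
  rw [hfun]
  refine h2.congr_fderiv ?_
  ext v
  have hq := congrFun hfun y
  simp only [gaussKernelGrad, hq, smul_apply, ContinuousLinearMap.comp_apply,
    ContinuousLinearMap.id_apply, innerSL_apply_apply, inner_smul_left, smul_eq_mul,
    inner_sub_left, nsmul_eq_mul, RCLike.conj_to_real]
  push_cast
  simp only [mul_inv]
  ring

/-- The kernel gradient is dominated by a Gaussian of twice the variance. -/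
theorem norm_gaussKernelGrad_le (d : ℕ) {σ : ℝ} (hσ : 0 < σ) (y x : EuclideanSpace ℝ (Fin d)) :
    ‖gaussKernelGrad d σ y x‖ ≤
      (2 * π * σ ^ 2) ^ (-(d : ℝ) / 2) * σ⁻¹ * Real.exp (-(4 * σ ^ 2)⁻¹ * ‖y - x‖ ^ 2) := by
  have hc : 0 < (2 * π * σ ^ 2) ^ (-(d : ℝ) / 2) := by positivity
  have ht : ‖y - x‖ ≤ σ * Real.exp ((4 * σ ^ 2)⁻¹ * ‖y - x‖ ^ 2) := by
    have h1 := Real.add_one_le_exp ((4 * σ ^ 2)⁻¹ * ‖y - x‖ ^ 2)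
    have h2 : ‖y - x‖ ≤ σ * ((4 * σ ^ 2)⁻¹ * ‖y - x‖ ^ 2 + 1) := by
      have : σ * ((4 * σ ^ 2)⁻¹ * ‖y - x‖ ^ 2 + 1) - ‖y - x‖ =
          (‖y - x‖ - 2 * σ) ^ 2 / (4 * σ) := by
        field_simp
        ring
      have : 0 ≤ (‖y - x‖ - 2 * σ) ^ 2 / (4 * σ) := by positivity
      linarith
    exact h2.trans (by gcongr)
  have hexp : Real.exp (-‖y - x‖ ^ 2 / (2 * σ ^ 2)) * Real.exp ((4 * σ ^ 2)⁻¹ * ‖y - x‖ ^ 2) =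
      Real.exp (-(4 * σ ^ 2)⁻¹ * ‖y - x‖ ^ 2) := by
    rw [← Real.exp_add]
    congr 1
    field_simp
    ring
  rw [gaussKernelGrad, norm_smul, norm_smul, Real.norm_of_nonneg (gaussKernel_pos d hσ y x).le,
    Real.norm_of_nonneg (by positivity), norm_sub_rev x y, gaussKernel]
  calc _ ≤ (2 * π * σ ^ 2) ^ (-(d : ℝ) / 2) * Real.exp (-‖y - x‖ ^ 2 / (2 * σ ^ 2)) *
        ((σ ^ 2)⁻¹ * (σ * Real.exp ((4 * σ ^ 2)⁻¹ * ‖y - x‖ ^ 2))) := by gcongr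
    _ = _ := by
      rw [← hexp]
      field_simp

theorem integrable_exp_neg_mul_sq_norm {V : Type*} [NormedAddCommGroup V] [InnerProductSpace ℝ V]
    [FiniteDimensional ℝ V] [MeasurableSpace V] [BorelSpace V] {b : ℝ} (hb : 0 < b) :
    Integrable fun v : V => Real.exp (-b * ‖v‖ ^ 2) := by
  by_contra h
  have h1 := GaussianFourier.integral_rexp_neg_mul_sq_norm (V := V) hb
  rw [integral_undef h] at h1
  have : 0 < (π / b) ^ (Module.finrank ℝ V / 2 : ℝ) := by positivity
  exact this.ne h1

theorem integrable_prod_comp_sub {V : Type*} [NormedAddCommGroup V] [InnerProductSpace ℝ V]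
    [FiniteDimensional ℝ V] [MeasurableSpace V] [BorelSpace V] (P : Measure V) [IsFiniteMeasure P]
    {h : V → ℝ} (hc : Continuous h) (hi : Integrable h) :
    Integrable (fun p : V × V => h (p.2 - p.1)) (P.prod volume) := by
  have hm : AEStronglyMeasurable (fun p : V × V => h (p.2 - p.1)) (P.prod volume) :=
    Continuous.aestronglyMeasurable (by fun_prop)
  refine (integrable_prod_iff hm).2 ⟨Eventually.of_forall fun x => hi.comp_sub_right x, ?_⟩
  have : (fun x => ∫ y, ‖h (y - x)‖) = fun _ => ∫ y, ‖h y‖ := by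
    funext x
    exact integral_sub_right_eq_self (fun y => ‖h y‖) x
  simp only [this]
  exact integrable_const _

section Smoothing

variable (d : ℕ) {σ : ℝ} (P : Measure (EuclideanSpace ℝ (Fin d))) [IsProbabilityMeasure P]

theorem integrable_gaussKernel (hσ : 0 < σ) (y : EuclideanSpace ℝ (Fin d)) :
    Integrable (fun x => gaussKernel d σ y x) P := by
  refine Integrable.of_bound (C := (2 * π * σ ^ 2) ^ (-(d : ℝ) / 2))
    ((continuous_gaussKernel d σ).comp (.prodMk_left y)).aestronglyMeasurable
    (Eventually.of_forall fun x => ?_)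
  rw [Real.norm_of_nonneg (gaussKernel_pos d hσ y x).le, gaussKernel]
  refine mul_le_of_le_one_right (by positivity) (Real.exp_le_one_iff.2 ?_)
  exact div_nonpos_of_nonpos_of_nonneg (by simp) (by positivity)

theorem norm_gaussKernelGrad_le_const (hσ : 0 < σ) (y x : EuclideanSpace ℝ (Fin d)) :
    ‖gaussKernelGrad d σ y x‖ ≤ (2 * π * σ ^ 2) ^ (-(d : ℝ) / 2) * σ⁻¹ := by
  refine (norm_gaussKernelGrad_le d hσ y x).trans
    (mul_le_of_le_one_right (by positivity) (Real.exp_le_one_iff.2 ?_))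
  have : 0 ≤ (4 * σ ^ 2)⁻¹ * ‖y - x‖ ^ 2 := by positivity
  linarith

theorem integrable_gaussKernelGrad (hσ : 0 < σ) (y : EuclideanSpace ℝ (Fin d)) :
    Integrable (fun x => gaussKernelGrad d σ y x) P :=
  Integrable.of_bound
    ((continuous_gaussKernelGrad d σ).comp (.prodMk_left y)).aestronglyMeasurable _
    (Eventually.of_forall fun x => norm_gaussKernelGrad_le_const d hσ y x)

theorem smoothedDensity_pos (hσ : 0 < σ) (y : EuclideanSpace ℝ (Fin d)) :
    0 < smoothedDensity d σ P y := by
  refine (integral_pos_iff_support_of_nonneg (fun x => (gaussKernel_pos d hσ y x).le)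
    (integrable_gaussKernel d P hσ y)).2 ?_
  have : Function.support (fun x => gaussKernel d σ y x) = Set.univ :=
    Set.eq_univ_of_forall fun x => (gaussKernel_pos d hσ y x).ne'
  simp [this]

theorem hasGradientAt_smoothedDensity (hσ : 0 < σ) (y : EuclideanSpace ℝ (Fin d)) :
    HasGradientAt (smoothedDensity d σ P) (∫ x, gaussKernelGrad d σ y x ∂P) y := by
  have h := hasFDerivAt_integral_of_dominated_of_fderiv_le (μ := P) (𝕜 := ℝ)
    (F := fun z x => gaussKernel d σ z x)
    (F' := fun z x => innerSL ℝ (gaussKernelGrad d σ z x)) (x₀ := y) (s := Set.univ)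
    (bound := fun _ => (2 * π * σ ^ 2) ^ (-(d : ℝ) / 2) * σ⁻¹) univ_mem
    (Eventually.of_forall fun z => (integrable_gaussKernel d P hσ z).aestronglyMeasurable)
    (integrable_gaussKernel d P hσ y)
    ((innerSL ℝ).continuous.comp_aestronglyMeasurable
      (integrable_gaussKernelGrad d P hσ y).aestronglyMeasurable)
    (Eventually.of_forall fun x z _ => by
      rw [innerSL_apply_norm]
      exact norm_gaussKernelGrad_le_const d hσ z x)
    (integrable_const _)
    (Eventually.of_forall fun x z _ => hasFDerivAt_gaussKernel d σ z x)
  rw [hasGradientAt_iff_hasFDerivAt]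
  refine h.congr_fderiv ?_
  exact (innerSL ℝ).integral_comp_comm (integrable_gaussKernelGrad d P hσ y)

theorem smoothedDensity_smul_score (hσ : 0 < σ) (y : EuclideanSpace ℝ (Fin d)) :
    smoothedDensity d σ P y • score d σ P y = ∫ x, gaussKernelGrad d σ y x ∂P := by
  have hQ := (smoothedDensity_pos d P hσ y).ne'
  have h := (hasGradientAt_iff_hasFDerivAt.1 (hasGradientAt_smoothedDensity d P hσ y)).log hQ
  rw [← map_smul, ← hasGradientAt_iff_hasFDerivAt] at h
  rw [score, h.gradient, smul_inv_smul₀ hQ]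

end Smoothing

/-- The cross terms of the denoising and direct score-matching objectives coincide, and
both integrals are finite. -/
theorem cross_terms_eq
    (d : ℕ) (hd : 1 ≤ d)
    (P : Measure (EuclideanSpace ℝ (Fin d))) [IsProbabilityMeasure P]
    (hP : ∃ K : Set (EuclideanSpace ℝ (Fin d)), IsCompact K ∧ P Kᶜ = 0)
    (σ : ℝ) (hσ : 0 < σ)
    (g : EuclideanSpace ℝ (Fin d) → EuclideanSpace ℝ (Fin d))
    (hg : Measurable g) (hgb : ∃ C : ℝ, ∀ y, ‖g y‖ ≤ C) :
    Integrable (fun x => ∫ y, ⟪g y, (σ ^ 2)⁻¹ • (x - y)⟫_ℝ * gaussKernel d σ y x) P ∧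
    Integrable (fun y => ⟪g y, score d σ P y⟫_ℝ * smoothedDensity d σ P y) ∧
    (∫ x, (∫ y, ⟪g y, (σ ^ 2)⁻¹ • (x - y)⟫_ℝ * gaussKernel d σ y x) ∂P
      = ∫ y, ⟪g y, score d σ P y⟫_ℝ * smoothedDensity d σ P y) := by
  obtain ⟨C, hC⟩ := hgb
  have hker : ∀ x y, ⟪g y, (σ ^ 2)⁻¹ • (x - y)⟫_ℝ * gaussKernel d σ y x =
      ⟪g y, gaussKernelGrad d σ y x⟫_ℝ := fun x y => by
    rw [gaussKernelGrad, real_inner_smul_right _ _ (gaussKernel d σ y x), mul_comm]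
  have hscore : ∀ y, ⟪g y, score d σ P y⟫_ℝ * smoothedDensity d σ P y =
      ∫ x, ⟪g y, gaussKernelGrad d σ y x⟫_ℝ ∂P := fun y => by
    rw [integral_inner (integrable_gaussKernelGrad d P hσ y), ← smoothedDensity_smul_score d P hσ,
      real_inner_smul_right, mul_comm]
  simp only [hker, hscore]
  have hint : Integrable (fun p : EuclideanSpace ℝ (Fin d) × EuclideanSpace ℝ (Fin d) =>
      ⟪g p.2, gaussKernelGrad d σ p.2 p.1⟫_ℝ) (P.prod volume) := by
    have hdom := integrable_prod_comp_sub P (by fun_prop)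
      (integrable_exp_neg_mul_sq_norm (V := EuclideanSpace ℝ (Fin d))
        (b := (4 * σ ^ 2)⁻¹) (by positivity))
    refine (hdom.const_mul (C * ((2 * π * σ ^ 2) ^ (-(d : ℝ) / 2) * σ⁻¹))).mono'
      ((hg.comp measurable_snd).inner
        (continuous_gaussKernelGrad d σ).measurable).aestronglyMeasurable
      (Eventually.of_forall fun p => ?_)
    have hC0 : 0 ≤ C := (norm_nonneg _).trans (hC 0)
    rw [mul_assoc C]
    exact (norm_inner_le_norm _ _).trans
      (mul_le_mul (hC _) (norm_gaussKernelGrad_le d hσ _ _) (norm_nonneg _) hC0)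
  exact ⟨hint.integral_prod_left, hint.integral_prod_right, integral_integral_swap hint⟩
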